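/- arXiv:1702.08054 — 3 statements merged into one kernel-verified Lean document; each statement's English description precedes it below -/
import Mathlib

section
/- Let Λ ⊆ ℝ^K be a nonempty closed convex set and P_Λ the Euclidean nearest-point projection onto Λ. Let g : ℝ^K → ℝ be convex, let λ, λ* ∈ Λ, let f ∈ ℝ^K satisfy the subgradient inequality g(λ*) ≥ g(λ) + ⟨f, λ* − λ⟩, and let f̂ ∈ ℝ^K satisfy ‖f̂‖ ≤ G. Then for every ε > 0, ‖P_Λ(λ − ε f̂) − λ*‖² ≤ ‖λ − λ*‖² − 2ε( g(λ) − g(λ*) ) − 2ε⟨f̂ − f, λ − λ*⟩ + ε²G². -/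
open scoped InnerProductSpace

/-- A nearest point `p` of a convex set to `u` is at least as close as `u` to every point of
the set. -/
theorem norm_sub_sq_le_of_forall_dist_le {F : Type*} [NormedAddCommGroup F]
    [InnerProductSpace ℝ F] {s : Set F} (hs : Convex ℝ s) {u p : F} (hp : p ∈ s)
    (hmin : ∀ y ∈ s, dist u p ≤ dist u y) {v : F} (hv : v ∈ s) :
    ‖p - v‖ ^ 2 ≤ ‖u - v‖ ^ 2 := by
  have : Nonempty s := ⟨⟨p, hp⟩⟩
  have hinf : ‖u - p‖ = ⨅ w : s, ‖u - w‖ :=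
    le_antisymm (le_ciInf fun w => by simpa only [dist_eq_norm] using hmin w w.2)
      (ciInf_le ⟨0, by rintro _ ⟨w, rfl⟩; exact norm_nonneg _⟩ (⟨p, hp⟩ : s))
  have hinner := (norm_eq_iInf_iff_real_inner_le_zero hs hp).1 hinf v hv
  have hexp := norm_sub_sq_real (u - p) (v - p)
  rw [sub_sub_sub_cancel_right, norm_sub_rev v p] at hexp
  nlinarith [sq_nonneg ‖u - p‖]

/-- one-step descent inequality for the projected stochastic
subgradient step. `P` is the Euclidean nearest-point projection onto the
nonempty closed convex set `Λ`, `f` satisfies the subgradient inequality of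
`g` at `λ` against `λ*`, and `f̂` is bounded by `G`. -/
theorem stmt11 {K : ℕ}
    (Λ : Set (EuclideanSpace ℝ (Fin K)))
    (hΛne : Λ.Nonempty) (hΛcl : IsClosed Λ) (hΛcv : Convex ℝ Λ)
    (P : EuclideanSpace ℝ (Fin K) → EuclideanSpace ℝ (Fin K))
    (hP : ∀ x, P x ∈ Λ ∧ ∀ y ∈ Λ, dist x (P x) ≤ dist x y)
    (g : EuclideanSpace ℝ (Fin K) → ℝ) (hg : ConvexOn ℝ Set.univ g)
    (lam lamstar : EuclideanSpace ℝ (Fin K))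
    (hlam : lam ∈ Λ) (hstar : lamstar ∈ Λ)
    (f : EuclideanSpace ℝ (Fin K))
    (hsub : g lam + ⟪f, lamstar - lam⟫_ℝ ≤ g lamstar)
    (fhat : EuclideanSpace ℝ (Fin K)) (G : ℝ) (hfhat : ‖fhat‖ ≤ G)
    (ε : ℝ) (hε : 0 < ε) :
    ‖P (lam - ε • fhat) - lamstar‖ ^ 2 ≤
      ‖lam - lamstar‖ ^ 2 - 2 * ε * (g lam - g lamstar) -
        2 * ε * ⟪fhat - f, lam - lamstar⟫_ℝ + ε ^ 2 * G ^ 2 := by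
  have hproj := norm_sub_sq_le_of_forall_dist_le hΛcv (hP (lam - ε • fhat)).1
    (hP (lam - ε • fhat)).2 hstar
  have hexp : ‖lam - ε • fhat - lamstar‖ ^ 2 =
      ‖lam - lamstar‖ ^ 2 - 2 * ε * ⟪fhat, lam - lamstar⟫_ℝ + ε ^ 2 * ‖fhat‖ ^ 2 := by
    rw [sub_right_comm, norm_sub_sq_real, real_inner_smul_right, real_inner_comm, norm_smul,
      mul_pow, Real.norm_eq_abs, sq_abs]
    ring
  have hbound : ε ^ 2 * ‖fhat‖ ^ 2 ≤ ε ^ 2 * G ^ 2 := by gcongr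
  have hgap : g lam - g lamstar ≤ ⟪f, lam - lamstar⟫_ℝ := by
    rw [← neg_sub lam lamstar, inner_neg_right] at hsub
    linarith
  have hscaled := mul_le_mul_of_nonneg_left hgap hε.le
  rw [inner_sub_left]
  linarith
end

section
/- Let W, α > 0, λ > 0, 0 < C_min ≤ C_max, and let (γ₁, c₁), (γ₂, c₂) be pairs of positive reals. For i = 1, 2 set p*_i := min( max( Wλ/c_i, C_min/c_i ), C_max/c_i ) and V_i := λ W ln( p*_i γ_i / α ) − c_i p*_i. If γ₁/c₁ ≥ γ₂/c₂ then V₁ ≥ V₂, with strict inequality when γ₁/c₁ > γ₂/c₂. Consequently, for any finite nonempty family of caches with gains γ_i and costs c_i, every index maximizing γ_i/c_i also maximizes the per-cache objective λ W ln( p*_i γ_i / α ) − c_i p*_i (slow fading user selection). -/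
/-- The cost-clamped optimal power allocation at dual price `lam`. -/
noncomputable def pstar (W lam γ c Cmin Cmax : ℝ) : ℝ :=
  min (max (W * lam / c) (Cmin / c)) (Cmax / c)

/-- The slow-fading per-cache objective at dual price `lam`:
`λ W ln(p* γ / α) − c p*`. -/
noncomputable def slowVal (W α lam Cmin Cmax γ c : ℝ) : ℝ :=
  lam * W * Real.log (pstar W lam γ c Cmin Cmax * γ / α) -
    c * pstar W lam γ c Cmin Cmax

theorem pstar_eq_div (W lam γ Cmin Cmax : ℝ) {c : ℝ} (hc : 0 < c) :
    pstar W lam γ c Cmin Cmax = min (max (W * lam) Cmin) Cmax / c := by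
  rw [pstar, max_div_div_right hc.le, min_div_div_right hc.le]

theorem slowVal_eq (W α lam Cmin Cmax γ : ℝ) {c : ℝ} (hc : 0 < c) :
    slowVal W α lam Cmin Cmax γ c =
      lam * W * Real.log (min (max (W * lam) Cmin) Cmax / α * (γ / c)) -
        min (max (W * lam) Cmin) Cmax := by
  rw [slowVal, pstar_eq_div W lam γ Cmin Cmax hc, mul_div_cancel₀ _ hc.ne']
  congr 3
  ring

theorem slowVal_lt_slowVal {W α lam Cmin Cmax γ₁ c₁ γ₂ c₂ : ℝ}
    (hW : 0 < W) (hα : 0 < α) (hlam : 0 < lam) (hCmin : 0 < Cmin) (hCC : Cmin ≤ Cmax)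
    (hc₁ : 0 < c₁) (hγ₂ : 0 < γ₂) (hc₂ : 0 < c₂) (h : γ₂ / c₂ < γ₁ / c₁) :
    slowVal W α lam Cmin Cmax γ₂ c₂ < slowVal W α lam Cmin Cmax γ₁ c₁ := by
  have hK : 0 < min (max (W * lam) Cmin) Cmax :=
    lt_min (lt_max_of_lt_right hCmin) (hCmin.trans_le hCC)
  rw [slowVal_eq W α lam Cmin Cmax γ₁ hc₁, slowVal_eq W α lam Cmin Cmax γ₂ hc₂]
  gcongr

theorem slowVal_le_slowVal {W α lam Cmin Cmax γ₁ c₁ γ₂ c₂ : ℝ}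
    (hW : 0 < W) (hα : 0 < α) (hlam : 0 < lam) (hCmin : 0 < Cmin) (hCC : Cmin ≤ Cmax)
    (hc₁ : 0 < c₁) (hγ₂ : 0 < γ₂) (hc₂ : 0 < c₂) (h : γ₂ / c₂ ≤ γ₁ / c₁) :
    slowVal W α lam Cmin Cmax γ₂ c₂ ≤ slowVal W α lam Cmin Cmax γ₁ c₁ := by
  rcases h.lt_or_eq with h | h
  · exact (slowVal_lt_slowVal hW hα hlam hCmin hCC hc₁ hγ₂ hc₂ h).le
  · rw [slowVal_eq W α lam Cmin Cmax γ₁ hc₁, slowVal_eq W α lam Cmin Cmax γ₂ hc₂, h]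

/-- slow-fading user selection. The per-cache objective is
monotone (strictly, for strict inequality) in the ratio `γ/c`; consequently,
in any finite nonempty family of caches, every index maximizing `γ_i/c_i` also
maximizes the per-cache objective. -/
theorem stmt18 (W α lam Cmin Cmax : ℝ)
    (hW : 0 < W) (hα : 0 < α) (hlam : 0 < lam)
    (hCmin : 0 < Cmin) (hCC : Cmin ≤ Cmax) :
    (∀ γ₁ c₁ γ₂ c₂ : ℝ, 0 < γ₁ → 0 < c₁ → 0 < γ₂ → 0 < c₂ →
      γ₂ / c₂ ≤ γ₁ / c₁ →
      slowVal W α lam Cmin Cmax γ₂ c₂ ≤ slowVal W α lam Cmin Cmax γ₁ c₁) ∧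
    (∀ γ₁ c₁ γ₂ c₂ : ℝ, 0 < γ₁ → 0 < c₁ → 0 < γ₂ → 0 < c₂ →
      γ₂ / c₂ < γ₁ / c₁ →
      slowVal W α lam Cmin Cmax γ₂ c₂ < slowVal W α lam Cmin Cmax γ₁ c₁) ∧
    (∀ (ι : Type) (s : Finset ι) (γ c : ι → ℝ),
      (∀ i ∈ s, 0 < γ i) → (∀ i ∈ s, 0 < c i) →
      ∀ i ∈ s, (∀ j ∈ s, γ j / c j ≤ γ i / c i) →
        ∀ j ∈ s, slowVal W α lam Cmin Cmax (γ j) (c j) ≤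
          slowVal W α lam Cmin Cmax (γ i) (c i)) := by
  refine ⟨fun _ _ _ _ _ hc₁ hγ₂ hc₂ h ↦ slowVal_le_slowVal hW hα hlam hCmin hCC hc₁ hγ₂ hc₂ h,
    fun _ _ _ _ _ hc₁ hγ₂ hc₂ h ↦ slowVal_lt_slowVal hW hα hlam hCmin hCC hc₁ hγ₂ hc₂ h,
    fun _ s γ c hγ hc i hi hmax j hj ↦ ?_⟩
  exact slowVal_le_slowVal hW hα hlam hCmin hCC (hc i hi) (hγ j hj) (hc j hj) (hmax j hj)
end

section
/- Let W, α > 0, λ > 0, 0 < C_min ≤ C_max, and let (γ₁, c₁, ψ₁), (γ₂, c₂, ψ₂) be triples with γ_i, c_i > 0 and ψ_i ∈ ℝ. For i = 1, 2 set p*_i := min( max( Wλ/c_i, C_min/c_i ), C_max/c_i ) and V_i := λ W ln( p*_i γ_i / α ) + λ W ψ_i − c_i p*_i. If ln(γ₁/c₁) + ψ₁ ≥ ln(γ₂/c₂) + ψ₂ then V₁ ≥ V₂, with strict inequality when the former inequality is strict. Consequently, for any finite nonempty family of caches, every index maximizing ln(γ_i/c_i) + ψ_i also maximizes the per-cache objective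 λ W ln( p*_i γ_i / α ) + λ W ψ_i − c_i p*_i (fast fading user selection). -/
/-- The fast-fading per-cache objective at dual price `lam`:
`λ W ln(p* γ / α) + λ W ψ − c p*`. -/
noncomputable def fastVal (W α lam Cmin Cmax γ c ψ : ℝ) : ℝ :=
  lam * W * Real.log (pstar W lam γ c Cmin Cmax * γ / α) + lam * W * ψ -
    c * pstar W lam γ c Cmin Cmax

/-- The per-cache objective is an increasing affine function of `ln(γ/c) + ψ`, with coefficients
independent of the cache. -/
theorem fastVal_eq (W lam ψ : ℝ) {α Cmin Cmax γ c : ℝ} (hα : 0 < α) (hCmin : 0 < Cmin)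
    (hCC : Cmin ≤ Cmax) (hγ : 0 < γ) (hc : 0 < c) :
    fastVal W α lam Cmin Cmax γ c ψ =
      lam * W * (Real.log (γ / c) + ψ) +
        (lam * W * Real.log (min (max (W * lam) Cmin) Cmax / α) -
          min (max (W * lam) Cmin) Cmax) := by
  have hM : 0 < min (max (W * lam) Cmin) Cmax :=
    lt_min (lt_max_of_lt_right hCmin) (hCmin.trans_le hCC)
  rw [fastVal, pstar_eq_div W lam γ Cmin Cmax hc]
  generalize min (max (W * lam) Cmin) Cmax = M at hM ⊢
  have hsplit : M / c * γ / α = γ / c * (M / α) := by ring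
  rw [hsplit, Real.log_mul (div_pos hγ hc).ne' (div_pos hM hα).ne', mul_div_cancel₀ M hc.ne']
  ring

/-- fast-fading user selection. The per-cache objective is
monotone (strictly, for strict inequality) in `ln(γ/c) + ψ`; consequently, in
any finite nonempty family of caches, every index maximizing `ln(γ_i/c_i) + ψ_i`
also maximizes the per-cache objective. -/
theorem stmt19 (W α lam Cmin Cmax : ℝ)
    (hW : 0 < W) (hα : 0 < α) (hlam : 0 < lam)
    (hCmin : 0 < Cmin) (hCC : Cmin ≤ Cmax) :
    (∀ γ₁ c₁ ψ₁ γ₂ c₂ ψ₂ : ℝ, 0 < γ₁ → 0 < c₁ → 0 < γ₂ → 0 < c₂ →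
      Real.log (γ₂ / c₂) + ψ₂ ≤ Real.log (γ₁ / c₁) + ψ₁ →
      fastVal W α lam Cmin Cmax γ₂ c₂ ψ₂ ≤ fastVal W α lam Cmin Cmax γ₁ c₁ ψ₁) ∧
    (∀ γ₁ c₁ ψ₁ γ₂ c₂ ψ₂ : ℝ, 0 < γ₁ → 0 < c₁ → 0 < γ₂ → 0 < c₂ →
      Real.log (γ₂ / c₂) + ψ₂ < Real.log (γ₁ / c₁) + ψ₁ →
      fastVal W α lam Cmin Cmax γ₂ c₂ ψ₂ < fastVal W α lam Cmin Cmax γ₁ c₁ ψ₁) ∧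
    (∀ (ι : Type) (s : Finset ι) (γ c ψ : ι → ℝ),
      (∀ i ∈ s, 0 < γ i) → (∀ i ∈ s, 0 < c i) →
      ∀ i ∈ s, (∀ j ∈ s, Real.log (γ j / c j) + ψ j ≤ Real.log (γ i / c i) + ψ i) →
        ∀ j ∈ s, fastVal W α lam Cmin Cmax (γ j) (c j) (ψ j) ≤
          fastVal W α lam Cmin Cmax (γ i) (c i) (ψ i)) := by
  have hLW : 0 < lam * W := mul_pos hlam hW
  have mono : ∀ γ₁ c₁ ψ₁ γ₂ c₂ ψ₂ : ℝ, 0 < γ₁ → 0 < c₁ → 0 < γ₂ → 0 < c₂ →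
      Real.log (γ₂ / c₂) + ψ₂ ≤ Real.log (γ₁ / c₁) + ψ₁ →
      fastVal W α lam Cmin Cmax γ₂ c₂ ψ₂ ≤ fastVal W α lam Cmin Cmax γ₁ c₁ ψ₁ := by
    intro γ₁ c₁ ψ₁ γ₂ c₂ ψ₂ hγ₁ hc₁ hγ₂ hc₂ h
    rw [fastVal_eq W lam ψ₁ hα hCmin hCC hγ₁ hc₁, fastVal_eq W lam ψ₂ hα hCmin hCC hγ₂ hc₂]
    gcongr
  refine ⟨mono, ?_, ?_⟩
  · intro γ₁ c₁ ψ₁ γ₂ c₂ ψ₂ hγ₁ hc₁ hγ₂ hc₂ h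
    rw [fastVal_eq W lam ψ₁ hα hCmin hCC hγ₁ hc₁, fastVal_eq W lam ψ₂ hα hCmin hCC hγ₂ hc₂]
    gcongr
  · intro ι s γ c ψ hγ hc i hi hmax j hj
    exact mono _ _ _ _ _ _ (hγ i hi) (hc i hi) (hγ j hj) (hc j hj) (hmax j hj)
end
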